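/- Let 1 ≤ m ≤ n and 1 ≤ p ≤ n−1, let U ⊆ ℝ^m and V ⊆ ℝ^p be open sets, let P : U → ℝ^n be a smooth map whose derivative DP(x) has rank m at every x ∈ U, and let Q : V → ℝ^n ∖ {0} be a smooth map such that the derivative of ρ∘Q has rank p at every point of V, where ρ(x) = x/‖x‖. Define Φ(x,y) = Σ_{k=1}^{n} P_k(x)·Q_k(y) for (x,y) ∈ U × V. If A ⊆ U and B ⊆ V are compact sets with dim_H A + dim_H B > n + 1, then there exists y ∈ B such that the set Δ_{Φ,y}(A) = { Φ(x,y) : x ∈ A } has nonempty interior in ℝ. -/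

import Mathlib

open MeasureTheory
open scoped ENNReal

section

open Set Topology
open scoped NNReal CompactlySupported

/-- A weighted cover of `F` by members of a laminar family is at least as expensive as `F`. -/
theorem mul_outerMeasure_le_of_laminar {X κ : Type*} (M : OuterMeasure X) (D : κ → Set X)
    (w : κ → ℝ≥0∞) (hD : ∀ q q', D q ⊆ D q' ∨ D q' ⊆ D q ∨ Disjoint (D q) (D q'))
    (hw : ∀ q, M (D q) ≤ w q) (c : κ → ℝ≥0) (s : Finset κ) (F : Set X) (l : ℝ≥0)
    (hF : ∀ x ∈ F, l ≤ ∑ q ∈ s, c q * (D q).indicator 1 x) :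
    l * M F ≤ ∑ q ∈ s, c q * w q := by
  classical
  induction s using Finset.strongInduction generalizing F l with
  | H s ih =>
    rcases s.eq_empty_or_nonempty with rfl | hs
    · rcases F.eq_empty_or_nonempty with rfl | ⟨x, hx⟩
      · simp
      · have := hF x hx
        simp at this
        simp [this]
    obtain ⟨q₀, hq₀, hmax⟩ := s.exists_maximalFor D hs
    set s₁ := (s.erase q₀).filter fun q => D q ⊆ D q₀ with hs₁
    set s₂ := (s.erase q₀).filter fun q => ¬ D q ⊆ D q₀ with hs₂
    have hdisj : ∀ q ∈ s₂, Disjoint (D q) (D q₀) := by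
      intro q hq
      simp only [hs₂, Finset.mem_filter, Finset.mem_erase] at hq
      rcases hD q q₀ with h | h | h
      · exact absurd h hq.2
      · exact absurd (hmax hq.1.2 h) hq.2
      · exact h
    have hsum : ∀ {R : Type} [AddCommMonoid R] (g : κ → R),
        ∑ q ∈ s, g q = g q₀ + (∑ q ∈ s₁, g q + ∑ q ∈ s₂, g q) := by
      intro R _ g
      rw [← Finset.add_sum_erase s g hq₀, Finset.sum_filter_add_sum_filter_not]
    have hlt : ∀ t, t ⊆ s.erase q₀ → t ⊂ s := fun t ht =>
      lt_of_le_of_lt ht (Finset.erase_ssubset hq₀)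
    have h1 : ((l - c q₀ : ℝ≥0) : ℝ≥0∞) * M (F ∩ D q₀) ≤ ∑ q ∈ s₁, c q * w q := by
      refine ih s₁ (hlt _ (Finset.filter_subset _ _)) _ _ fun x hx => ?_
      have := hF x hx.1
      rw [hsum] at this
      have h0 : ∑ q ∈ s₂, c q * (D q).indicator (1 : X → ℝ≥0) x = 0 := by
        refine Finset.sum_eq_zero fun q hq => ?_
        rw [indicator_of_notMem, mul_zero]
        exact fun h => (Set.disjoint_left.1 (hdisj q hq)) h hx.2
      rw [h0, indicator_of_mem hx.2, add_zero, Pi.one_apply, mul_one] at this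
      exact tsub_le_iff_left.2 this
    have h2 : (l : ℝ≥0∞) * M (F \ D q₀) ≤ ∑ q ∈ s₂, c q * w q := by
      refine ih s₂ (hlt _ (Finset.filter_subset _ _)) _ _ fun x hx => ?_
      have := hF x hx.1
      rw [hsum] at this
      have h0 : ∑ q ∈ s₁, c q * (D q).indicator (1 : X → ℝ≥0) x = 0 := by
        refine Finset.sum_eq_zero fun q hq => ?_
        rw [indicator_of_notMem, mul_zero]
        exact fun h => hx.2 ((Finset.mem_filter.1 hq).2 h)
      rwa [h0, indicator_of_notMem hx.2, mul_zero, zero_add, zero_add] at this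
    calc (l : ℝ≥0∞) * M F ≤ l * (M (F ∩ D q₀) + M (F \ D q₀)) := by
          gcongr
          exact measure_le_inter_add_sdiff _ _ _
      _ = l * M (F ∩ D q₀) + l * M (F \ D q₀) := mul_add _ _ _
      _ ≤ (c q₀ * w q₀ + ∑ q ∈ s₁, c q * w q) + ∑ q ∈ s₂, c q * w q := by
          gcongr
          calc (l : ℝ≥0∞) * M (F ∩ D q₀)
              ≤ ((c q₀ : ℝ≥0∞) + ((l - c q₀ : ℝ≥0) : ℝ≥0∞)) * M (F ∩ D q₀) := by
                gcongr
                rw [← ENNReal.coe_add, ENNReal.coe_le_coe]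
                exact le_add_tsub
            _ ≤ _ := by
                rw [add_mul]
                gcongr
                exact (measure_mono inter_subset_right).trans (hw q₀)
      _ = _ := by rw [hsum, add_assoc]

/-- Hahn–Banach and Riesz–Markov: if every weighted cover of a compact space by the sets `D q` has
cost at least `m`, there is a measure of mass `m` which is bounded by the cost of covers. -/
theorem exists_measure_le_sum_cover {E κ : Type*} [TopologicalSpace E] [CompactSpace E] [T2Space E]
    [MeasurableSpace E] [BorelSpace E] (D : κ → Set E) (w : κ → ℝ≥0)
    (hcov : ∃ s : Finset κ, ∀ x, ∃ q ∈ s, x ∈ D q) (m : ℝ≥0)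
    (hm : ∀ c : κ →₀ ℝ≥0, (∀ x, 1 ≤ c.sum fun q a => a * (D q).indicator 1 x) →
      m ≤ c.sum fun q a => a * w q) :
    ∃ μ : Measure E, IsFiniteMeasure μ ∧ μ univ = m ∧
      ∀ (K O : Set E) (s : Finset κ), IsCompact K → IsOpen O → K ⊆ O →
        (∀ x ∈ O, ∃ q ∈ s, x ∈ D q) → μ K ≤ ∑ q ∈ s, w q := by
  classical
  let S : C_c(E, ℝ) → Set ℝ := fun f => {v | ∃ c : κ →₀ ℝ≥0,
    (∀ x, f x ≤ ((c.sum fun q a => a * (D q).indicator 1 x : ℝ≥0) : ℝ)) ∧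
    v = ((c.sum fun q a => a * w q : ℝ≥0) : ℝ)}
  let N : C_c(E, ℝ) → ℝ := fun f => sInf (S f)
  have hbdd : ∀ f, BddBelow (S f) := fun f => ⟨0, by
    rintro v ⟨c, -, rfl⟩
    positivity⟩
  have hne : ∀ f, (S f).Nonempty := by
    intro f
    obtain ⟨s, hs⟩ := hcov
    obtain ⟨b, hb⟩ := (isCompact_range f.continuous).bddAbove
    refine ⟨_, ∑ q ∈ s, Finsupp.single q b.toNNReal, fun x => ?_, rfl⟩
    rw [← Finsupp.sum_finsetSum_index (by simp) (by intros; ring)]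
    obtain ⟨q, hq, hx⟩ := hs x
    calc f x ≤ b := hb (mem_range_self x)
      _ ≤ b.toNNReal := Real.le_coe_toNNReal b
      _ ≤ _ := by
        rw [NNReal.coe_le_coe]
        refine le_trans ?_ (Finset.single_le_sum (f := fun q =>
          (Finsupp.single q b.toNNReal).sum fun q a => a * (D q).indicator 1 x)
          (fun _ _ => zero_le) hq)
        simp [Finsupp.sum_single_index, hx]
  have hle : ∀ (f : C_c(E, ℝ)) (s : Finset κ) (r : ℝ≥0),
      (∀ x, f x ≤ 0 ∨ f x ≤ r ∧ ∃ q ∈ s, x ∈ D q) → N f ≤ r * ∑ q ∈ s, w q := by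
    intro f s r h
    refine csInf_le (hbdd f) ⟨∑ q ∈ s, Finsupp.single q r, fun x => ?_, ?_⟩
    · rw [← Finsupp.sum_finsetSum_index (by simp) (by intros; ring)]
      rcases h x with h | ⟨h, q, hq, hx⟩
      · exact h.trans (by positivity)
      · refine h.trans ?_
        rw [NNReal.coe_le_coe]
        refine le_trans ?_ (Finset.single_le_sum (f := fun q =>
          (Finsupp.single q r).sum fun q a => a * (D q).indicator 1 x)
          (fun _ _ => zero_le) hq)
        simp [Finsupp.sum_single_index, hx]
    · rw [← Finsupp.sum_finsetSum_index (by simp) (by intros; ring)]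
      simp [Finsupp.sum_single_index, Finset.mul_sum]
  have hN0 : ∀ f, 0 ≤ N f := fun f => Real.sInf_nonneg (by
    rintro v ⟨c, -, rfl⟩
    positivity)
  have hNhom_le : ∀ c : ℝ, 0 < c → ∀ f, N (c • f) ≤ c * N f := by
    intro c hc f
    rw [← div_le_iff₀' hc]
    refine le_csInf (hne f) ?_
    rintro v ⟨d, hd, rfl⟩
    rw [div_le_iff₀' hc]
    refine csInf_le (hbdd _) ⟨c.toNNReal • d, fun x => ?_, ?_⟩
    · rw [Finsupp.sum_smul_index (by simp)]
      simp only [mul_assoc]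
      rw [← Finsupp.mul_sum]
      simp only [CompactlySupportedContinuousMap.smul_apply, smul_eq_mul, NNReal.coe_mul,
        Real.coe_toNNReal c hc.le]
      gcongr
      exact hd x
    · rw [Finsupp.sum_smul_index (by simp)]
      simp only [mul_assoc]
      rw [← Finsupp.mul_sum, NNReal.coe_mul, Real.coe_toNNReal c hc.le]
  have hNhom : ∀ c : ℝ, 0 < c → ∀ f, N (c • f) = c * N f := by
    intro c hc f
    refine le_antisymm (hNhom_le c hc f) ?_
    have := hNhom_le c⁻¹ (inv_pos.2 hc) (c • f)
    rw [smul_smul, inv_mul_cancel₀ hc.ne', one_smul] at this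
    rwa [le_inv_mul_iff₀ hc] at this
  have hNadd : ∀ f g, N (f + g) ≤ N f + N g := by
    intro f g
    rw [← sub_le_iff_le_add]
    refine le_csInf (hne f) ?_
    rintro _ ⟨c, hc, rfl⟩
    rw [sub_le_comm]
    refine le_csInf (hne g) ?_
    rintro _ ⟨d, hd, rfl⟩
    rw [sub_le_iff_le_add']
    refine csInf_le (hbdd _) ⟨c + d, fun x => ?_, ?_⟩
    · rw [Finsupp.sum_add_index' (by simp) (by intros; ring)]
      rw [NNReal.coe_add]
      exact add_le_add (hc x) (hd x)
    · rw [Finsupp.sum_add_index' (by simp) (by intros; ring)]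
      push_cast
      rfl
  let one : C_c(E, ℝ) := ⟨1, HasCompactSupport.of_compactSpace _⟩
  have hone : ∀ x, one x = 1 := fun _ => rfl
  have hN1 : (m : ℝ) ≤ N one := by
    refine le_csInf (hne _) ?_
    rintro _ ⟨c, hc, rfl⟩
    rw [NNReal.coe_le_coe]
    refine hm c fun x => ?_
    have := hc x
    rw [hone] at this
    exact_mod_cast this
  obtain ⟨g, hg1, hgN⟩ : ∃ g : C_c(E, ℝ) →ₗ[ℝ] ℝ, g one = m ∧ ∀ f, g f ≤ N f := by
    by_cases h1 : one = 0
    · have : IsEmpty E := ⟨fun x => by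
        have := hone x
        rw [h1] at this
        simp at this⟩
      refine ⟨0, ?_, fun f => by simpa using hN0 f⟩
      have := hm 0 (fun x => (IsEmpty.false x).elim)
      simp at this
      simp [this]
    · obtain ⟨g, hg, hgN⟩ := exists_extension_of_le_sublinear
        (LinearPMap.mkSpanSingleton one (m : ℝ) h1) N hNhom hNadd (by
          rintro ⟨x, hx⟩
          obtain ⟨a, rfl⟩ := Submodule.mem_span_singleton.1 hx
          rw [LinearPMap.mkSpanSingleton'_apply, smul_eq_mul, RingHom.id_apply]
          rcases le_or_gt a 0 with ha | ha
          · exact (mul_nonpos_of_nonpos_of_nonneg ha m.2).trans (hN0 _)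
          · rw [hNhom a ha]
            gcongr)
      refine ⟨g, ?_, hgN⟩
      exact (hg ⟨one, Submodule.mem_span_singleton_self one⟩).trans
        (LinearPMap.mkSpanSingleton_apply ℝ ℝ h1 (m : ℝ))
  have hgpos : ∀ f : C_c(E, ℝ), 0 ≤ f → 0 ≤ g f := by
    intro f hf
    have : g (-f) ≤ 0 := (hgN _).trans ((hle (-f) ∅ 0 fun x => Or.inl (by
      simpa using hf x)).trans (by simp))
    simpa using this
  let Λ : C_c(E, ℝ) →ₚ[ℝ] ℝ := PositiveLinearMap.mk₀ g hgpos
  have hΛ : ∀ f, Λ f = g f := fun _ => rfl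
  have huniv : RealRMK.rieszMeasure Λ univ = m := by
    have hofReal : ENNReal.ofReal (Λ one) = m := by rw [hΛ, hg1, ENNReal.ofReal_coe_nnreal]
    rw [← hofReal]
    exact le_antisymm
      (RealRMK.rieszMeasure_le_of_eq_one Λ (fun _ => zero_le_one) isCompact_univ fun x _ => hone x)
      (RealRMK.le_rieszMeasure_tsupport_subset Λ
        (fun x => ⟨zero_le_one, (hone x).le⟩) (subset_univ _))
  refine ⟨RealRMK.rieszMeasure Λ, ⟨by rw [huniv]; exact ENNReal.coe_lt_top⟩, huniv, ?_⟩
  intro K O s hK hO hKO hs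
  obtain ⟨f, hf1, hf0, hfs, hf⟩ := exists_continuous_one_zero_of_isCompact hK hO.isClosed_compl
    (disjoint_compl_right_iff_subset.2 hKO)
  refine (RealRMK.rieszMeasure_le_of_eq_one Λ (f := ⟨f, hfs⟩) (fun x => (hf x).1) hK hf1).trans ?_
  rw [hΛ]
  refine ENNReal.ofReal_le_of_le_toReal ((hgN _).trans ?_)
  refine (hle _ s 1 fun x => ?_).trans ?_
  · by_cases hx : x ∈ O
    · exact Or.inr ⟨(hf x).2, hs x hx⟩
    · exact Or.inl (hf0 hx).le
  · simp [ENNReal.toReal_sum]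

/-- The half-open dyadic cube of side `2⁻ᵏ` with index `z`. -/
def dyadicCube {n : ℕ} (k : ℕ) (z : Fin n → ℤ) : Set (EuclideanSpace ℝ (Fin n)) :=
  {x | ∀ i, ⌊2 ^ k * x i⌋ = z i}

theorem floor_two_pow_mul_eq {a b : ℝ} {k l : ℕ} (hkl : k ≤ l)
    (h : ⌊2 ^ l * a⌋ = ⌊2 ^ l * b⌋) : ⌊2 ^ k * a⌋ = ⌊2 ^ k * b⌋ := by
  have key : ∀ c : ℝ, ⌊2 ^ k * c⌋ = ⌊2 ^ l * c⌋ / ((2 ^ (l - k) : ℕ) : ℤ) := by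
    intro c
    rw [← Int.floor_div_natCast]
    congr 1
    obtain ⟨d, rfl⟩ := Nat.exists_eq_add_of_le hkl
    simp only [add_tsub_cancel_left, pow_add, Nat.cast_pow, Nat.cast_ofNat]
    field_simp
  rw [key a, key b, h]

theorem dyadicCube_laminar {n : ℕ} (k l : ℕ) (z z' : Fin n → ℤ) :
    dyadicCube k z ⊆ dyadicCube l z' ∨ dyadicCube l z' ⊆ dyadicCube k z ∨
      Disjoint (dyadicCube k z) (dyadicCube l z') := by
  by_cases hd : Disjoint (dyadicCube k z) (dyadicCube l z')
  · exact Or.inr (Or.inr hd)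
  obtain ⟨y, hy, hy'⟩ := Set.not_disjoint_iff.1 hd
  rcases le_total k l with h | h
  · exact Or.inr (Or.inl fun x hx i =>
      (floor_two_pow_mul_eq h ((hx i).trans (hy' i).symm)).trans (hy i))
  · exact Or.inl fun x hx i =>
      (floor_two_pow_mul_eq h ((hx i).trans (hy i).symm)).trans (hy' i)

theorem ediam_dyadicCube_le {n : ℕ} (k : ℕ) (z : Fin n → ℤ) :
    Metric.ediam (dyadicCube k z) ≤ ((n * (2 ^ k)⁻¹ : ℝ≥0) : ℝ≥0∞) := by
  refine Metric.ediam_le fun x hx y hy => ?_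
  rw [edist_le_coe, ← NNReal.coe_le_coe, coe_nndist, EuclideanSpace.dist_eq]
  push_cast
  have hi : ∀ i, dist (x i) (y i) ≤ (2 ^ k)⁻¹ := by
    intro i
    have h := Int.abs_sub_lt_one_of_floor_eq_floor ((hx i).trans (hy i).symm)
    rw [← mul_sub, abs_mul, abs_of_pos (by positivity : (0 : ℝ) < 2 ^ k)] at h
    rw [Real.dist_eq, inv_eq_one_div, le_div_iff₀' (by positivity)]
    exact h.le
  rw [Real.sqrt_le_left (by positivity)]
  calc ∑ i, dist (x i) (y i) ^ 2 ≤ ∑ _i : Fin n, ((2 ^ k)⁻¹ : ℝ) ^ 2 := by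
        gcongr with i
        exact hi i
    _ = n * ((2 ^ k)⁻¹) ^ 2 := by simp
    _ ≤ n ^ 2 * ((2 ^ k)⁻¹) ^ 2 := by
        gcongr
        exact_mod_cast Nat.le_self_pow two_ne_zero n
    _ = (n * (2 ^ k)⁻¹) ^ 2 := by ring

theorem exists_dyadicCube_cover_ball {n : ℕ} (k : ℕ) (x : EuclideanSpace ℝ (Fin n)) :
    ∃ s : Finset (Fin n → ℤ), s.card = 3 ^ n ∧
      ∀ y ∈ Metric.ball x (2 ^ k)⁻¹, ∃ z ∈ s, y ∈ dyadicCube k z := by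
  refine ⟨Fintype.piFinset fun i => Finset.Icc (⌊2 ^ k * x i⌋ - 1) (⌊2 ^ k * x i⌋ + 1),
    ?_, fun y hy => ⟨fun i => ⌊2 ^ k * y i⌋, ?_, fun i => rfl⟩⟩
  · rw [Fintype.card_piFinset]
    have : ∀ a : ℤ, (a + 1 + 1 - (a - 1)).toNat = 3 := by intro a; omega
    simp [this]
  · rw [Fintype.mem_piFinset]
    intro i
    have h1 : |y i - x i| < (2 ^ k)⁻¹ := by
      refine lt_of_le_of_lt ?_ (Metric.mem_ball.1 hy)
      rw [dist_eq_norm]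
      exact PiLp.norm_apply_le (y - x) i
    rw [inv_eq_one_div, lt_div_iff₀' (by positivity),
      ← abs_of_pos (by positivity : (0 : ℝ) < 2 ^ k), ← abs_mul, mul_sub, abs_lt] at h1
    rw [Finset.mem_Icc]
    constructor
    · rw [Int.le_floor]
      push_cast
      linarith [Int.floor_le (2 ^ k * x i)]
    · rw [← Int.lt_add_one_iff, Int.floor_lt]
      push_cast
      linarith [Int.lt_floor_add_one (2 ^ k * x i)]

/-- **Frostman's lemma** for compact subsets of Euclidean space. -/
theorem exists_frostman_measure {n : ℕ} {E : Set (EuclideanSpace ℝ (Fin n))} (hE : IsCompact E)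
    {s : ℝ≥0} (hs : (s : ℝ≥0∞) < dimH E) :
    ∃ μ : Measure (EuclideanSpace ℝ (Fin n)), IsFiniteMeasure μ ∧ μ univ ≠ 0 ∧ μ Eᶜ = 0 ∧
      ∃ C : ℝ, 0 ≤ C ∧ ∀ x, ∀ r : ℝ, 0 < r →
        μ (Metric.closedBall x r) ≤ ENNReal.ofReal (C * r ^ (s : ℝ)) := by
  classical
  let M : ℝ≥0∞ → OuterMeasure (EuclideanSpace ℝ (Fin n)) :=
    OuterMeasure.mkMetric'.pre fun A => Metric.ediam A ^ (s : ℝ)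
  obtain ⟨r₀, hr₀, hME⟩ : ∃ r > 0, M r E ≠ 0 := by
    by_contra! h
    have h1 : μH[s] E = ⊤ := hausdorffMeasure_of_lt_dimH hs
    have h2 : μH[s] E = 0 := by
      rw [Measure.hausdorffMeasure, ← Measure.coe_toOuterMeasure, Measure.mkMetric_toOuterMeasure,
        OuterMeasure.mkMetric, OuterMeasure.mkMetric']
      simp only [OuterMeasure.iSup_apply, ENNReal.iSup_eq_zero]
      exact h
    simp [h2] at h1
  obtain ⟨m, hm0, hmE⟩ := ENNReal.lt_iff_exists_nnreal_btwn.1 (pos_iff_ne_zero.2 hME)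
  obtain ⟨k₀, hk₀⟩ : ∃ k₀ : ℕ, ((n * (2 ^ k₀)⁻¹ : ℝ≥0) : ℝ≥0∞) ≤ r₀ := by
    obtain ⟨r, hr, hrr⟩ := ENNReal.lt_iff_exists_nnreal_btwn.1 hr₀
    have hr' : 0 < r := by exact_mod_cast hr
    obtain ⟨k, hk⟩ := exists_pow_lt_of_lt_one (show 0 < r / (n + 1) by positivity)
      (show (2⁻¹ : ℝ≥0) < 1 by exact inv_lt_one_of_one_lt₀ one_lt_two)
    refine ⟨k, le_trans ?_ hrr.le⟩
    rw [ENNReal.coe_le_coe, ← inv_pow]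
    rw [lt_div_iff₀' (by positivity)] at hk
    refine le_trans ?_ hk.le
    gcongr
    exact le_self_add
  let w : ℕ × (Fin n → ℤ) → ℝ≥0 := fun q => (n * (2 ^ (q.1 + k₀))⁻¹ : ℝ≥0) ^ (s : ℝ)
  let D : ℕ × (Fin n → ℤ) → Set (EuclideanSpace ℝ (Fin n)) := fun q => dyadicCube (q.1 + k₀) q.2
  have hMD : ∀ q, M r₀ (D q) ≤ w q := by
    intro q
    have hdiam := ediam_dyadicCube_le (q.1 + k₀) q.2
    refine (OuterMeasure.mkMetric'.pre_le (hdiam.trans (le_trans ?_ hk₀))).trans ?_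
    · rw [ENNReal.coe_le_coe]
      gcongr
      · exact one_le_two
      · omega
    · rw [show (w q : ℝ≥0∞) = ((n * (2 ^ (q.1 + k₀))⁻¹ : ℝ≥0) : ℝ≥0∞) ^ (s : ℝ) from
        ENNReal.coe_rpow_of_nonneg _ s.2]
      exact ENNReal.rpow_le_rpow hdiam s.2
  have : CompactSpace E := isCompact_iff_compactSpace.1 hE
  have hball : ∀ (k : ℕ) (x : EuclideanSpace ℝ (Fin n)), ∃ t : Finset (ℕ × (Fin n → ℤ)),
      (∀ y ∈ Metric.ball x (2 ^ (k + k₀))⁻¹, ∃ q ∈ t, y ∈ D q) ∧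
      ∑ q ∈ t, w q = 3 ^ n * (n * (2 ^ (k + k₀))⁻¹ : ℝ≥0) ^ (s : ℝ) := by
    intro k x
    obtain ⟨t, ht, hcov⟩ := exists_dyadicCube_cover_ball (k + k₀) x
    refine ⟨t.map ⟨fun z => (k, z), Prod.mk_right_injective k⟩, fun y hy => ?_, ?_⟩
    · obtain ⟨z, hz, hyz⟩ := hcov y hy
      exact ⟨(k, z), Finset.mem_map.2 ⟨z, hz, rfl⟩, hyz⟩
    · simp [w, ht]
  obtain ⟨μ, hμfin, hμ1, hμ⟩ := exists_measure_le_sum_cover (E := E) (fun q => (↑) ⁻¹' D q) w (by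
      choose t ht _ using hball
      obtain ⟨b, -, hb⟩ := hE.elim_nhds_subcover (fun x => Metric.ball x (2 ^ (0 + k₀))⁻¹)
        (fun x _ => Metric.ball_mem_nhds x (by positivity))
      refine ⟨b.biUnion (t 0), fun x => ?_⟩
      obtain ⟨y, hy, hxy⟩ := mem_iUnion₂.1 (hb x.2)
      obtain ⟨q, hq, hxq⟩ := ht 0 y x hxy
      exact ⟨q, Finset.mem_biUnion.2 ⟨y, hy, hq⟩, hxq⟩) m (by
      intro c hc
      have := mul_outerMeasure_le_of_laminar (M r₀) D (fun q => w q)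
        (fun q q' => dyadicCube_laminar _ _ _ _) hMD c c.support E 1 (fun x hx => hc ⟨x, hx⟩)
      rw [ENNReal.coe_one, one_mul] at this
      have := hmE.le.trans this
      exact_mod_cast this)
  refine ⟨μ.map (↑), inferInstance, ?_, ?_, 3 ^ n * (4 * n) ^ (s : ℝ) + m * (2 * 2 ^ k₀) ^ (s : ℝ),
    by positivity, fun x r hr => ?_⟩
  · rw [Measure.map_apply measurable_subtype_coe MeasurableSet.univ, preimage_univ, hμ1]
    exact hm0.ne'
  · rw [Measure.map_apply measurable_subtype_coe hE.measurableSet.compl]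
    simp
  rw [Measure.map_apply measurable_subtype_coe measurableSet_closedBall]
  rcases le_or_gt (2 * 2 ^ k₀ * r) 1 with h | h
  · obtain ⟨k, hk1, hk2⟩ := exists_nat_pow_near_of_lt_one (show 0 < 2 * 2 ^ k₀ * r by positivity) h
      (show (0 : ℝ) < 2⁻¹ by norm_num) (by norm_num)
    obtain ⟨t, ht, htw⟩ := hball k x
    have hr1 : r < (2 ^ (k + k₀))⁻¹ := by
      rw [pow_add, mul_inv, ← inv_pow, ← div_eq_mul_inv, lt_div_iff₀ (by positivity)]
      nlinarith [pow_pos (show (0 : ℝ) < 2 by norm_num) k₀]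
    have hr2 : ((2 ^ (k + k₀))⁻¹ : ℝ) ≤ 4 * r := by
      rw [pow_add, mul_inv, ← inv_pow, ← div_eq_mul_inv, div_le_iff₀ (by positivity)]
      rw [pow_succ] at hk1
      nlinarith [pow_pos (show (0 : ℝ) < 2 by norm_num) k₀]
    refine (hμ _ ((↑) ⁻¹' Metric.ball x (2 ^ (k + k₀))⁻¹) t
      (Metric.isClosed_closedBall.preimage continuous_subtype_val).isCompact
      (Metric.isOpen_ball.preimage continuous_subtype_val)
      (preimage_mono (Metric.closedBall_subset_ball hr1)) (fun y hy => ht y hy)).trans ?_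
    rw [htw, ← ENNReal.ofReal_coe_nnreal]
    refine ENNReal.ofReal_le_ofReal ?_
    push_cast
    rw [add_mul, mul_assoc, ← Real.mul_rpow (by positivity) hr.le]
    refine le_add_of_le_of_nonneg ?_ (by positivity)
    have : (n * (2 ^ (k + k₀))⁻¹ : ℝ) ≤ 4 * n * r := by
      nlinarith [(Nat.cast_nonneg n : (0 : ℝ) ≤ n)]
    gcongr
  · refine (measure_mono (subset_univ _)).trans ?_
    rw [hμ1, ← ENNReal.ofReal_coe_nnreal]
    refine ENNReal.ofReal_le_ofReal ?_
    rw [add_mul, mul_assoc (m : ℝ), ← Real.mul_rpow (by positivity) hr.le]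
    refine le_add_of_nonneg_of_le (by positivity) ?_
    exact le_mul_of_one_le_right m.2 (Real.one_le_rpow h.le s.2)

theorem summable_add_one_rpow_mul_exp_neg (s : ℝ) :
    Summable fun k : ℕ => Real.exp (-k) * ((k : ℝ) + 1) ^ s := by
  have h := ((summable_nat_add_iff 1).2
    (Real.summable_pow_mul_exp_neg_nat_mul ⌈s⌉₊ one_pos)).mul_left (Real.exp 1)
  refine h.of_nonneg_of_le (fun k => by positivity) fun k => ?_
  have h1 : ((k : ℝ) + 1) ^ s ≤ ((k : ℝ) + 1) ^ ⌈s⌉₊ := by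
    rw [← Real.rpow_natCast]
    exact Real.rpow_le_rpow_of_exponent_le (by linarith [k.cast_nonneg (α := ℝ)]) (Nat.le_ceil s)
  have h2 : Real.exp (-k) = Real.exp 1 * Real.exp (-1 * ((k + 1 : ℕ) : ℝ)) := by
    rw [← Real.exp_add]; congr 1; push_cast; ring
  rw [h2]
  push_cast
  calc _ ≤ Real.exp 1 * Real.exp (-1 * ((k : ℝ) + 1)) * ((k : ℝ) + 1) ^ ⌈s⌉₊ := by gcongr
    _ = _ := by ring

/-- Growth of balls controls Gaussian averages. -/
theorem lintegral_gaussian_le_of_measure_closedBall_le {X : Type*} [PseudoMetricSpace X]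
    [MeasurableSpace X] [BorelSpace X] {μ : Measure X} {s C : ℝ} (hC : 0 ≤ C)
    (h : ∀ x, ∀ r : ℝ, 0 < r → μ (Metric.closedBall x r) ≤ ENNReal.ofReal (C * r ^ s)) :
    ∃ K : ℝ, 0 ≤ K ∧ ∀ x, ∀ b : ℝ, 0 < b →
      ∫⁻ y, ENNReal.ofReal (Real.exp (-b * dist y x ^ 2)) ∂μ ≤
        ENNReal.ofReal (K * b ^ (-s / 2)) := by
  have hsum := summable_add_one_rpow_mul_exp_neg s
  refine ⟨C * ∑' k : ℕ, Real.exp (-k) * ((k : ℝ) + 1) ^ s,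
    mul_nonneg hC (tsum_nonneg fun k => by positivity), fun x b hb => ?_⟩
  have hb' : 0 < √b := Real.sqrt_pos.2 hb
  have hpt (y : X) : ENNReal.ofReal (Real.exp (-b * dist y x ^ 2)) ≤
      ∑' k : ℕ, (Metric.closedBall x (((k : ℝ) + 1) / √b)).indicator
        (fun _ => ENNReal.ofReal (Real.exp (-k))) y := by
    set d := dist y x * √b with hd
    have hd0 : 0 ≤ d := by positivity
    refine le_trans ?_ (ENNReal.le_tsum ⌊d⌋₊)
    rw [indicator_of_mem]
    · refine ENNReal.ofReal_le_ofReal (Real.exp_le_exp.2 ?_)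
      have h1 : (⌊d⌋₊ : ℝ) ≤ d := Nat.floor_le hd0
      have h2 : b * dist y x ^ 2 = d ^ 2 := by rw [hd, mul_pow, Real.sq_sqrt hb.le]; ring
      have h3 : (⌊d⌋₊ : ℝ) ≤ (⌊d⌋₊ : ℝ) ^ 2 := by
        exact_mod_cast Nat.le_self_pow two_ne_zero _
      have h4 : (⌊d⌋₊ : ℝ) ^ 2 ≤ d ^ 2 := by gcongr
      linarith
    · rw [Metric.mem_closedBall, le_div_iff₀ hb']
      exact (Nat.lt_floor_add_one d).le
  calc _ ≤ ∫⁻ y, ∑' k : ℕ, (Metric.closedBall x (((k : ℝ) + 1) / √b)).indicator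
        (fun _ => ENNReal.ofReal (Real.exp (-k))) y ∂μ := lintegral_mono hpt
    _ = ∑' k : ℕ, ENNReal.ofReal (Real.exp (-k)) *
          μ (Metric.closedBall x (((k : ℝ) + 1) / √b)) := by
        rw [lintegral_tsum fun k =>
          (measurable_const.indicator Metric.isClosed_closedBall.measurableSet).aemeasurable]
        exact tsum_congr fun k => lintegral_indicator_const Metric.isClosed_closedBall.measurableSet _
    _ ≤ ∑' k : ℕ, ENNReal.ofReal (C * b ^ (-s / 2) * (Real.exp (-k) * ((k : ℝ) + 1) ^ s)) := by
        refine ENNReal.tsum_le_tsum fun k => ?_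
        grw [h x _ (by positivity), ← ENNReal.ofReal_mul (by positivity)]
        refine ENNReal.ofReal_le_ofReal (le_of_eq ?_)
        rw [Real.div_rpow (by positivity) (by positivity), Real.sqrt_eq_rpow,
          ← Real.rpow_mul hb.le, neg_div, Real.rpow_neg hb.le, one_div_mul_eq_div]
        field_simp
    _ = _ := by
        rw [← ENNReal.ofReal_tsum_of_nonneg (fun k => by positivity) (hsum.mul_left _),
          tsum_mul_left]
        congr 1; ring

theorem integral_charFun_add_mul_gaussian {V : Type*} [NormedAddCommGroup V]
    [InnerProductSpace ℝ V] [FiniteDimensional ℝ V] [MeasurableSpace V] [BorelSpace V]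
    (η : Measure V) [IsFiniteMeasure η] {b : ℝ} (hb : 0 < b) (ζ : V) :
    ∫ ξ, charFun η (ζ + ξ) * Complex.exp (-b * ‖ξ‖ ^ 2) =
      (Real.pi / b : ℂ) ^ (Module.finrank ℝ V / 2 : ℂ) *
        ∫ z, Complex.exp (inner ℝ z ζ * Complex.I) * Real.exp (-‖z‖ ^ 2 / (4 * b)) ∂η := by
  have hb' : 0 < (b : ℂ).re := hb
  simp_rw [charFun_apply, ← integral_mul_const]
  rw [integral_integral_swap]
  · rw [← integral_const_mul]
    refine integral_congr_ae (.of_forall fun z => ?_)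
    have h := GaussianFourier.integral_cexp_neg_mul_sq_norm_add hb' Complex.I z
    simp only
    calc _ = ∫ ξ, Complex.exp (inner ℝ z ζ * Complex.I) *
          Complex.exp (-b * ‖ξ‖ ^ 2 + Complex.I * inner ℝ z ξ) := by
          refine integral_congr_ae (.of_forall fun ξ => ?_)
          simp only [inner_add_right, ← Complex.exp_add]
          congr 1; push_cast; ring
      _ = _ := by
          rw [integral_const_mul, h, Complex.I_sq]
          push_cast
          rw [neg_one_mul]
          ring
  · have hg : Integrable (fun ξ : V => Complex.exp (-b * ‖ξ‖ ^ 2)) := by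
      simpa using GaussianFourier.integrable_cexp_neg_mul_sq_norm_add hb' 0 (0 : V)
    have h2 : Integrable (fun p : V × V => Complex.exp (-b * ‖p.1‖ ^ 2)) (volume.prod η) :=
      hg.comp_fst η
    refine h2.bdd_mul (c := 1) (by fun_prop) (.of_forall fun p => ?_)
    rw [Complex.norm_exp_ofReal_mul_I]

theorem sq_lintegral_le_measure_univ_mul_lintegral_sq {α : Type*} [MeasurableSpace α]
    (ν : Measure α) {f : α → ℝ≥0∞} (hf : AEMeasurable f ν) :
    (∫⁻ x, f x ∂ν) ^ 2 ≤ ν univ * ∫⁻ x, f x ^ 2 ∂ν := by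
  have h := ENNReal.lintegral_mul_le_Lp_mul_Lq ν Real.HolderConjugate.two_two hf
    (aemeasurable_const (b := (1 : ℝ≥0∞)))
  simp only [Pi.mul_apply, mul_one, ENNReal.one_rpow, lintegral_const, one_mul] at h
  calc _ ≤ ((∫⁻ x, f x ^ (2 : ℝ) ∂ν) ^ (1 / 2 : ℝ) * ν univ ^ (1 / 2 : ℝ)) ^ 2 := by gcongr
    _ = _ := by
      rw [mul_pow, ← ENNReal.rpow_natCast, ← ENNReal.rpow_natCast, ← ENNReal.rpow_mul,
        ← ENNReal.rpow_mul, mul_comm]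
      norm_num

theorem neg_sq_norm_sub_smul_le {V : Type*} [NormedAddCommGroup V] [InnerProductSpace ℝ V]
    {R r : ℝ} (hR : 1 ≤ R) (hr : r ∈ Icc R (2 * R)) {e : V} (he : ‖e‖ = 1) (ξ : V) :
    -‖ξ - r • e‖ ^ 2 ≤ 2 + -(1 / (4 * R ^ 2)) * ‖ξ‖ ^ 2 + -(1 / 4) * ‖r - ‖ξ‖‖ ^ 2 +
      -(1 / 4) * ‖ξ - r • e‖ ^ 2 := by
  have hr0 : 0 < r := by linarith [hr.1]
  have hre : ‖r • e‖ = r := by rw [norm_smul, he, mul_one, Real.norm_of_nonneg hr0.le]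
  have h1 : ‖r - ‖ξ‖‖ ≤ ‖ξ - r • e‖ := by
    have := abs_norm_sub_norm_le (r • e) ξ
    rwa [hre, norm_sub_rev] at this
  have h2 : ‖ξ‖ ≤ 2 * R + ‖ξ - r • e‖ := by
    have := norm_le_norm_add_norm_sub' ξ (r • e)
    linarith [hr.2, hre]
  set x := ‖ξ - r • e‖
  have hx : 0 ≤ x := norm_nonneg _
  have h3 : ‖ξ‖ ^ 2 ≤ 8 * R ^ 2 + 2 * x ^ 2 := by
    have : ‖ξ‖ ^ 2 ≤ (2 * R + x) ^ 2 := by gcongr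
    nlinarith [sq_nonneg (2 * R - x)]
  have h4 : 1 / (4 * R ^ 2) * ‖ξ‖ ^ 2 ≤ 2 + x ^ 2 / 2 := by
    rw [one_div_mul_eq_div, div_le_iff₀ (by positivity)]
    nlinarith [mul_nonneg (sq_nonneg x) (by nlinarith : 0 ≤ R ^ 2 - 1)]
  have h5 : ‖r - ‖ξ‖‖ ^ 2 ≤ x ^ 2 := by gcongr
  nlinarith

theorem integrable_of_norm_neg_eq {f : ℝ → ℂ} (hm : StronglyMeasurable f)
    (hf : ∀ r, ‖f (-r)‖ = ‖f r‖) (h : IntegrableOn f (Ici 0)) : Integrable f := by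
  have hneg : IntegrableOn (fun r => f (-r)) (Ici 0) := by
    refine Integrable.mono h ((hm.comp_measurable measurable_neg).aestronglyMeasurable)
      (.of_forall fun r => (hf r).le)
  have h2 : IntegrableOn f (Iic 0) := by
    have := (Measure.measurePreserving_neg (volume : Measure ℝ)).integrableOn_comp_preimage
      (Homeomorph.neg ℝ).measurableEmbedding (f := f) (s := Iic 0)
    rw [← this]
    simpa [Function.comp_def] using hneg
  rw [← integrableOn_univ, ← Iic_union_Ici (a := (0 : ℝ))]
  exact h2.union h

section Gaussian

variable {V : Type*} [NormedAddCommGroup V] [InnerProductSpace ℝ V] [FiniteDimensional ℝ V]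
  [MeasurableSpace V] [BorelSpace V]

theorem integrable_rexp_neg_mul_sq_norm {b : ℝ} (hb : 0 < b) :
    Integrable fun v : V => Real.exp (-b * ‖v‖ ^ 2) := by
  have h := (GaussianFourier.integrable_cexp_neg_mul_sq_norm_add (b := b) hb 0 (0 : V)).re
  refine h.congr (.of_forall fun v => ?_)
  simp only [zero_mul, add_zero]
  rw [← Complex.ofReal_neg, ← Complex.ofReal_pow, ← Complex.ofReal_mul]
  exact Complex.exp_ofReal_re _

/-- The Gaussian-weighted Fourier energy of a measure with ball growth of order `s`. -/
theorem lintegral_charFun_sq_mul_gaussian_le {μ : Measure V} [IsFiniteMeasure μ] {s C : ℝ}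
    (hC : 0 ≤ C)
    (h : ∀ x, ∀ r : ℝ, 0 < r → μ (Metric.closedBall x r) ≤ ENNReal.ofReal (C * r ^ s)) :
    ∃ K : ℝ, 0 ≤ K ∧ ∀ b : ℝ, 0 < b →
      ∫⁻ ξ, ‖charFun μ ξ‖ₑ ^ 2 * ENNReal.ofReal (Real.exp (-b * ‖ξ‖ ^ 2)) ≤
        ENNReal.ofReal (K * b ^ ((s - Module.finrank ℝ V) / 2)) := by
  obtain ⟨K, hK, hKb⟩ := lintegral_gaussian_le_of_measure_closedBall_le hC h
  set d : ℝ := (Module.finrank ℝ V : ℝ) with hd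
  refine ⟨Real.pi ^ (d / 2) * (K * 4 ^ (s / 2) * μ.real univ), by positivity, fun b hb => ?_⟩
  set η : Measure V := μ.conv (μ.map ((-1 : ℝ) • ·)) with hη
  have hchar (ξ : V) : charFun η ξ = (‖charFun μ ξ‖ ^ 2 : ℝ) := by
    rw [hη, charFun_conv, charFun_map_smul, neg_one_smul, charFun_neg, Complex.mul_conj,
      Complex.normSq_eq_norm_sq]
  have hfg := integral_charFun_add_mul_gaussian η hb 0
  simp only [zero_add, inner_zero_right, Complex.ofReal_zero, zero_mul, Complex.exp_zero,
    one_mul, hchar] at hfg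
  have hfg' : ∫ ξ, ‖charFun μ ξ‖ ^ 2 * Real.exp (-b * ‖ξ‖ ^ 2) =
      (Real.pi / b) ^ (d / 2) * ∫ z, Real.exp (-‖z‖ ^ 2 / (4 * b)) ∂η := by
    apply Complex.ofReal_injective
    rw [Complex.ofReal_mul, ← integral_complex_ofReal, ← integral_complex_ofReal,
      Complex.ofReal_cpow (by positivity)]
    push_cast at hfg ⊢
    exact hfg
  have hint : Integrable fun ξ : V => ‖charFun μ ξ‖ ^ 2 * Real.exp (-b * ‖ξ‖ ^ 2) := by
    refine (integrable_rexp_neg_mul_sq_norm hb).bdd_mul (c := μ.real univ ^ 2)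
      (by have := (stronglyMeasurable_charFun (μ := μ)).norm.aestronglyMeasurable (μ := volume)
          exact this.pow 2) (.of_forall fun ξ => ?_)
    rw [Real.norm_of_nonneg (by positivity)]
    gcongr
    exact norm_charFun_le ξ
  have hη_le : ∫⁻ z, ENNReal.ofReal (Real.exp (-‖z‖ ^ 2 / (4 * b))) ∂η ≤
      ENNReal.ofReal (K * (1 / (4 * b)) ^ (-s / 2)) * μ univ := by
    rw [hη, Measure.lintegral_conv (by fun_prop), ← lintegral_const]
    refine lintegral_mono fun x => ?_
    rw [lintegral_map (by fun_prop) (by fun_prop)]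
    refine le_trans (lintegral_mono fun y => ?_) (hKb x (1 / (4 * b)) (by positivity))
    refine ENNReal.ofReal_le_ofReal (le_of_eq ?_)
    rw [neg_one_smul, ← sub_eq_add_neg, dist_comm, dist_eq_norm]
    congr 1; ring
  have hηint : Integrable (fun z : V => Real.exp (-‖z‖ ^ 2 / (4 * b))) η := by
    refine .of_bound (by fun_prop) 1 (.of_forall fun z => ?_)
    rw [Real.norm_of_nonneg (Real.exp_nonneg _), Real.exp_le_one_iff]
    have : 0 ≤ ‖z‖ ^ 2 / (4 * b) := by positivity
    linarith [neg_div (4 * b) (‖z‖ ^ 2)]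
  calc _ = ∫⁻ ξ, ENNReal.ofReal (‖charFun μ ξ‖ ^ 2 * Real.exp (-b * ‖ξ‖ ^ 2)) := by
        refine lintegral_congr fun ξ => ?_
        rw [ENNReal.ofReal_mul (by positivity), ENNReal.ofReal_pow (norm_nonneg _),
          ofReal_norm]
    _ = ENNReal.ofReal ((Real.pi / b) ^ (d / 2)) *
          ∫⁻ z, ENNReal.ofReal (Real.exp (-‖z‖ ^ 2 / (4 * b))) ∂η := by
        rw [← ofReal_integral_eq_lintegral_ofReal hint (.of_forall fun _ => by positivity), hfg',
          ENNReal.ofReal_mul (by positivity),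
          ofReal_integral_eq_lintegral_ofReal hηint (.of_forall fun _ => by positivity)]
    _ ≤ _ := by
        grw [hη_le, ← ofReal_measureReal (measure_ne_top μ univ),
          ← ENNReal.ofReal_mul (by positivity), ← ENNReal.ofReal_mul (by positivity)]
        refine ENNReal.ofReal_le_ofReal (le_of_eq ?_)
        rw [Real.div_rpow Real.pi_nonneg hb.le, one_div, Real.inv_rpow (by positivity),
          neg_div, Real.rpow_neg (by positivity), inv_inv, Real.mul_rpow (by norm_num) hb.le,
          sub_div, Real.rpow_sub hb]
        ring

theorem exists_charFun_withDensity_gaussian_sq_le (μ : Measure V) [IsFiniteMeasure μ] :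
    ∃ c : ℝ, 0 ≤ c ∧ ∀ ζ,
      ‖charFun (μ.withDensity fun z => ENNReal.ofReal (Real.exp (-‖z‖ ^ 2 / 4))) ζ‖ₑ ^ 2 ≤
        ENNReal.ofReal c *
          ∫⁻ ξ, ‖charFun μ ξ‖ₑ ^ 2 * ENNReal.ofReal (Real.exp (-‖ξ - ζ‖ ^ 2)) := by
  set c₀ : ℂ := (Real.pi / (1 : ℝ) : ℂ) ^ (Module.finrank ℝ V / 2 : ℂ) with hc₀
  have hc₀' : c₀ ≠ 0 := by
    rw [hc₀, Complex.cpow_ne_zero_iff]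
    left
    simp [Real.pi_ne_zero]
  have hg1 : Integrable fun v : V => Real.exp (-‖v‖ ^ 2) := by
    simpa using integrable_rexp_neg_mul_sq_norm (V := V) one_pos
  set I := ∫ v : V, Real.exp (-‖v‖ ^ 2) with hI
  have hI0 : 0 ≤ I := integral_nonneg fun v => Real.exp_nonneg _
  refine ⟨(‖c₀‖⁻¹) ^ 2 * I, by positivity, fun ζ => ?_⟩
  have hfg := integral_charFun_add_mul_gaussian μ one_pos ζ
  rw [← hc₀] at hfg
  have hdens : charFun (μ.withDensity fun z => ENNReal.ofReal (Real.exp (-‖z‖ ^ 2 / 4))) ζ =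
      ∫ z, Complex.exp (inner ℝ z ζ * Complex.I) *
        Real.exp (-‖z‖ ^ 2 / (4 * (1 : ℝ))) ∂μ := by
    rw [charFun_apply, integral_withDensity_eq_integral_toReal_smul (by fun_prop)
      (.of_forall fun _ => ENNReal.ofReal_lt_top)]
    refine integral_congr_ae (.of_forall fun z => ?_)
    simp only [ENNReal.toReal_ofReal (Real.exp_nonneg _), Complex.real_smul, mul_one]
    ring
  rw [← hdens] at hfg
  set G : Measure V := volume.withDensity fun ξ => ENNReal.ofReal (Real.exp (-‖ξ‖ ^ 2)) with hG
  have hmeas : Measurable fun ξ : V => ‖charFun μ (ζ + ξ)‖ₑ :=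
    (measurable_charFun.comp (measurable_const_add ζ)).enorm
  have hGu : G univ = ENNReal.ofReal I := by
    rw [hG, withDensity_apply _ .univ, Measure.restrict_univ,
      ofReal_integral_eq_lintegral_ofReal hg1 (.of_forall fun _ => Real.exp_nonneg _)]
  have hnorm : ‖c₀‖ₑ * ‖charFun (μ.withDensity fun z =>
      ENNReal.ofReal (Real.exp (-‖z‖ ^ 2 / 4))) ζ‖ₑ ≤ ∫⁻ ξ, ‖charFun μ (ζ + ξ)‖ₑ ∂G := by
    rw [← enorm_mul, ← hfg, hG, lintegral_withDensity_eq_lintegral_mul _ (by fun_prop) hmeas]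
    refine (enorm_integral_le_lintegral_enorm _).trans (lintegral_mono fun ξ => ?_)
    simp only [Pi.mul_apply]
    rw [enorm_mul, mul_comm]
    gcongr
    rw [← ofReal_norm, Complex.norm_exp]
    refine ENNReal.ofReal_le_ofReal (Real.exp_le_exp.2 (le_of_eq ?_))
    rw [← Complex.ofReal_neg, ← Complex.ofReal_pow, ← Complex.ofReal_mul, Complex.ofReal_re]
    ring
  have hc1 : ENNReal.ofReal ‖c₀‖⁻¹ * ‖c₀‖ₑ = 1 := by
    rw [← ofReal_norm, ← ENNReal.ofReal_mul (by positivity),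
      inv_mul_cancel₀ (norm_ne_zero_iff.2 hc₀'), ENNReal.ofReal_one]
  have hshift : ∫⁻ ξ, ‖charFun μ (ζ + ξ)‖ₑ ^ 2 ∂G =
      ∫⁻ ξ, ‖charFun μ ξ‖ₑ ^ 2 * ENNReal.ofReal (Real.exp (-‖ξ - ζ‖ ^ 2)) := by
    rw [hG, lintegral_withDensity_eq_lintegral_mul _ (by fun_prop) (hmeas.pow_const 2),
      ← lintegral_add_left_eq_self (fun ξ => ‖charFun μ ξ‖ₑ ^ 2 * _) ζ]
    refine lintegral_congr fun ξ => ?_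
    simp only [Pi.mul_apply, add_sub_cancel_left, mul_comm]
  calc _ = (ENNReal.ofReal ‖c₀‖⁻¹ * (‖c₀‖ₑ * ‖charFun (μ.withDensity fun z =>
          ENNReal.ofReal (Real.exp (-‖z‖ ^ 2 / 4))) ζ‖ₑ)) ^ 2 := by
        rw [← mul_assoc, hc1, one_mul]
    _ ≤ (ENNReal.ofReal ‖c₀‖⁻¹ * ∫⁻ ξ, ‖charFun μ (ζ + ξ)‖ₑ ∂G) ^ 2 := by gcongr
    _ ≤ ENNReal.ofReal ‖c₀‖⁻¹ ^ 2 * (G univ * ∫⁻ ξ, ‖charFun μ (ζ + ξ)‖ₑ ^ 2 ∂G) := by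
        rw [mul_pow]
        gcongr
        exact sq_lintegral_le_measure_univ_mul_lintegral_sq G hmeas.aemeasurable
    _ = _ := by
        rw [hshift, hGu, ENNReal.ofReal_mul (by positivity), ENNReal.ofReal_pow (by positivity),
          mul_assoc]

theorem exists_lintegral_gaussian_annulus_le {ν : Measure V} [IsFiniteMeasure ν] {t C : ℝ}
    (ht : 0 ≤ t) (hC : 0 ≤ C)
    (h : ∀ x, ∀ r : ℝ, 0 < r → ν (Metric.closedBall x r) ≤ ENNReal.ofReal (C * r ^ t))
    (hν : ∀ᵐ e ∂ν, ‖e‖ = 1) :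
    ∃ K : ℝ, 0 ≤ K ∧ ∀ R : ℝ, 1 ≤ R → ∀ ξ : V,
      ∫⁻ r in Icc R (2 * R), ∫⁻ e, ENNReal.ofReal (Real.exp (-‖ξ - r • e‖ ^ 2)) ∂ν ≤
        ENNReal.ofReal (K * R ^ (-t) * Real.exp (-(1 / (4 * R ^ 2)) * ‖ξ‖ ^ 2)) := by
  obtain ⟨K, hK, hKb⟩ := lintegral_gaussian_le_of_measure_closedBall_le hC h
  have hg : Integrable fun v : ℝ => Real.exp (-(1 / 4) * ‖v‖ ^ 2) :=
    integrable_rexp_neg_mul_sq_norm (by norm_num)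
  set I := ∫ v : ℝ, Real.exp (-(1 / 4) * ‖v‖ ^ 2) with hI
  have hI0 : 0 ≤ I := integral_nonneg fun v => Real.exp_nonneg _
  refine ⟨Real.exp 2 * (K * 4 ^ (t / 2)) * I, by positivity, fun R hR ξ => ?_⟩
  have hR0 : 0 < R := by linarith
  have hinner (r : ℝ) (hr : r ∈ Icc R (2 * R)) :
      ∫⁻ e, ENNReal.ofReal (Real.exp (-‖ξ - r • e‖ ^ 2)) ∂ν ≤
        ENNReal.ofReal (Real.exp 2 * Real.exp (-(1 / (4 * R ^ 2)) * ‖ξ‖ ^ 2) *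
          (K * (4 ^ (t / 2) * R ^ (-t)))) *
          ENNReal.ofReal (Real.exp (-(1 / 4) * ‖r - ‖ξ‖‖ ^ 2)) := by
    have hr0 : 0 < r := by linarith [hr.1]
    have hdist (e : V) : -(1 / 4) * ‖ξ - r • e‖ ^ 2 = -(r ^ 2 / 4) * dist e (r⁻¹ • ξ) ^ 2 := by
      rw [dist_comm, dist_eq_norm]
      have : ξ - r • e = r • (r⁻¹ • ξ - e) := by rw [smul_sub, smul_inv_smul₀ hr0.ne']
      rw [this, norm_smul, mul_pow, Real.norm_of_nonneg hr0.le]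
      ring
    calc _ ≤ ∫⁻ e, ENNReal.ofReal (Real.exp 2 * Real.exp (-(1 / (4 * R ^ 2)) * ‖ξ‖ ^ 2) *
            Real.exp (-(1 / 4) * ‖r - ‖ξ‖‖ ^ 2)) *
            ENNReal.ofReal (Real.exp (-(r ^ 2 / 4) * dist e (r⁻¹ • ξ) ^ 2)) ∂ν := by
          refine lintegral_mono_ae ?_
          filter_upwards [hν] with e he
          rw [← ENNReal.ofReal_mul (by positivity), ← Real.exp_add, ← Real.exp_add,
            ← Real.exp_add, ← hdist]
          exact ENNReal.ofReal_le_ofReal (Real.exp_le_exp.2 (neg_sq_norm_sub_smul_le hR hr he ξ))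
      _ ≤ ENNReal.ofReal (Real.exp 2 * Real.exp (-(1 / (4 * R ^ 2)) * ‖ξ‖ ^ 2) *
            Real.exp (-(1 / 4) * ‖r - ‖ξ‖‖ ^ 2)) *
            ENNReal.ofReal (K * (r ^ 2 / 4) ^ (-t / 2)) := by
          rw [lintegral_const_mul _ (by fun_prop)]
          gcongr
          exact hKb _ _ (by positivity)
      _ ≤ _ := by
          rw [← ENNReal.ofReal_mul (by positivity), ← ENNReal.ofReal_mul (by positivity)]
          refine ENNReal.ofReal_le_ofReal ?_
          have : (r ^ 2 / 4) ^ (-t / 2) ≤ 4 ^ (t / 2) * R ^ (-t) := by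
            rw [Real.div_rpow (by positivity) (by norm_num), neg_div,
              Real.rpow_neg (x := 4) zero_le_four, div_inv_eq_mul, mul_comm,
              ← Real.rpow_natCast_mul hr0.le]
            gcongr 4 ^ (t / 2) * ?_
            have : ((2 : ℕ) : ℝ) * -(t / 2) = -t := by push_cast; ring
            rw [this]
            exact Real.rpow_le_rpow_of_nonpos hR0 hr.1 (by linarith)
          calc _ ≤ Real.exp 2 * Real.exp (-(1 / (4 * R ^ 2)) * ‖ξ‖ ^ 2) *
                Real.exp (-(1 / 4) * ‖r - ‖ξ‖‖ ^ 2) * (K * (4 ^ (t / 2) * R ^ (-t))) := by gcongr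
            _ = _ := by ring
  calc _ ≤ ∫⁻ r in Icc R (2 * R), ENNReal.ofReal
          (Real.exp 2 * Real.exp (-(1 / (4 * R ^ 2)) * ‖ξ‖ ^ 2) *
          (K * (4 ^ (t / 2) * R ^ (-t)))) *
          ENNReal.ofReal (Real.exp (-(1 / 4) * ‖r - ‖ξ‖‖ ^ 2)) :=
        setLIntegral_mono' measurableSet_Icc hinner
    _ ≤ ∫⁻ r, ENNReal.ofReal
          (Real.exp 2 * Real.exp (-(1 / (4 * R ^ 2)) * ‖ξ‖ ^ 2) *
          (K * (4 ^ (t / 2) * R ^ (-t)))) *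
          ENNReal.ofReal (Real.exp (-(1 / 4) * ‖r - ‖ξ‖‖ ^ 2)) := setLIntegral_le_lintegral _ _
    _ = ENNReal.ofReal
          (Real.exp 2 * Real.exp (-(1 / (4 * R ^ 2)) * ‖ξ‖ ^ 2) *
          (K * (4 ^ (t / 2) * R ^ (-t)))) * ENNReal.ofReal I := by
        rw [lintegral_const_mul _ (by fun_prop),
          lintegral_sub_right_eq_self (fun r : ℝ => ENNReal.ofReal
            (Real.exp (-(1 / 4) * ‖r‖ ^ 2))) ‖ξ‖, hI,
          ofReal_integral_eq_lintegral_ofReal hg (.of_forall fun _ => Real.exp_nonneg _)]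
    _ = _ := by
        rw [← ENNReal.ofReal_mul (by positivity)]
        congr 1; ring

theorem exists_lintegral_charFun_annulus_le {μ ν : Measure V} [IsFiniteMeasure μ]
    [IsFiniteMeasure ν] {s t C D : ℝ} (ht : 0 ≤ t) (hC : 0 ≤ C) (hD : 0 ≤ D)
    (hμ : ∀ x, ∀ r : ℝ, 0 < r → μ (Metric.closedBall x r) ≤ ENNReal.ofReal (C * r ^ s))
    (hν : ∀ x, ∀ r : ℝ, 0 < r → ν (Metric.closedBall x r) ≤ ENNReal.ofReal (D * r ^ t))
    (hν1 : ∀ᵐ e ∂ν, ‖e‖ = 1) :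
    ∃ K : ℝ, 0 ≤ K ∧ ∀ R : ℝ, 1 ≤ R →
      ∫⁻ r in Icc R (2 * R), ∫⁻ e, ‖charFun (μ.withDensity fun z =>
        ENNReal.ofReal (Real.exp (-‖z‖ ^ 2 / 4))) (r • e)‖ₑ ∂ν ≤
        ENNReal.ofReal (K * R ^ (-(s + t - Module.finrank ℝ V - 1) / 2)) := by
  obtain ⟨c, hc, hcζ⟩ := exists_charFun_withDensity_gaussian_sq_le μ
  obtain ⟨K₁, hK₁, hE⟩ := lintegral_charFun_sq_mul_gaussian_le hC hμ
  obtain ⟨K₂, hK₂, hW⟩ := exists_lintegral_gaussian_annulus_le ht hD hν hν1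
  set μ' := μ.withDensity fun z => ENNReal.ofReal (Real.exp (-‖z‖ ^ 2 / 4)) with hμ'
  set d : ℝ := (Module.finrank ℝ V : ℝ) with hd
  set K₃ := ν.real univ * (c * (K₂ * (K₁ * (1 / 4) ^ ((s - d) / 2)))) with hK₃
  have hK₃0 : 0 ≤ K₃ := by positivity
  refine ⟨√K₃, by positivity, fun R hR => ?_⟩
  have hR0 : 0 < R := by linarith
  set ρ := (volume.restrict (Icc R (2 * R))).prod ν with hρ
  have hmeas : Measurable fun p : ℝ × V => ‖charFun μ' (p.1 • p.2)‖ₑ :=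
    (measurable_charFun.comp (measurable_fst.smul measurable_snd)).enorm
  have hF : Measurable fun ξ => ‖charFun μ ξ‖ₑ ^ 2 := measurable_charFun.enorm.pow_const 2
  have hGm : Measurable fun q : (ℝ × V) × V =>
      ENNReal.ofReal (Real.exp (-‖q.2 - q.1.1 • q.1.2‖ ^ 2)) := by fun_prop
  have hJ : ∫⁻ p, ‖charFun μ' (p.1 • p.2)‖ₑ ^ 2 ∂ρ ≤
      ENNReal.ofReal (c * (K₂ * (K₁ * (1 / 4) ^ ((s - d) / 2))) * R ^ (d - s - t)) := by
    calc _ ≤ ∫⁻ p, ENNReal.ofReal c * (∫⁻ ξ, ‖charFun μ ξ‖ₑ ^ 2 *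
            ENNReal.ofReal (Real.exp (-‖ξ - p.1 • p.2‖ ^ 2))) ∂ρ :=
          lintegral_mono fun p => hcζ _
      _ = ENNReal.ofReal c * ∫⁻ ξ, ‖charFun μ ξ‖ₑ ^ 2 *
            ∫⁻ p, ENNReal.ofReal (Real.exp (-‖ξ - p.1 • p.2‖ ^ 2)) ∂ρ := by
          rw [lintegral_const_mul' _ _ ENNReal.ofReal_ne_top, lintegral_lintegral_swap]
          · congr 1
            refine lintegral_congr fun ξ => ?_
            rw [lintegral_const_mul _ (by fun_prop)]
          · exact ((hF.comp measurable_snd).mul hGm).aemeasurable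
      _ ≤ ENNReal.ofReal c * ∫⁻ ξ, ENNReal.ofReal (K₂ * R ^ (-t)) * (‖charFun μ ξ‖ₑ ^ 2 *
            ENNReal.ofReal (Real.exp (-(1 / (4 * R ^ 2)) * ‖ξ‖ ^ 2))) := by
          refine mul_le_mul_right (lintegral_mono fun ξ => ?_) _
          rw [mul_left_comm, ← ENNReal.ofReal_mul (by positivity), hρ,
            lintegral_prod _ (by fun_prop)]
          gcongr
          exact hW R hR ξ
      _ ≤ ENNReal.ofReal c * (ENNReal.ofReal (K₂ * R ^ (-t)) *
            ENNReal.ofReal (K₁ * (1 / (4 * R ^ 2)) ^ ((s - d) / 2))) := by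
          rw [lintegral_const_mul' _ _ ENNReal.ofReal_ne_top]
          gcongr
          exact hE _ (by positivity)
      _ = _ := by
          rw [← ENNReal.ofReal_mul (by positivity), ← ENNReal.ofReal_mul (by positivity)]
          have h1 : (1 / (4 * R ^ 2)) ^ ((s - d) / 2) = (1 / 4) ^ ((s - d) / 2) * R ^ (d - s) := by
            have : 1 / (4 * R ^ 2) = 1 / 4 * R ^ (-2 : ℝ) := by
              rw [Real.rpow_neg hR0.le, Real.rpow_two]; field_simp
            rw [this, Real.mul_rpow (by norm_num) (by positivity), ← Real.rpow_mul hR0.le]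
            congr 2; ring
          have h2 : R ^ (d - s - t) = R ^ (-t) * R ^ (d - s) := by
            rw [← Real.rpow_add hR0]; congr 1; ring
          rw [h1, h2]
          congr 1; ring
  have hρu : ρ univ = ENNReal.ofReal (R * ν.real univ) := by
    rw [hρ, ← univ_prod_univ, Measure.prod_prod, Measure.restrict_apply_univ, Real.volume_Icc,
      ENNReal.ofReal_mul hR0.le, ofReal_measureReal]
    congr 2; ring
  have hsq : (∫⁻ p, ‖charFun μ' (p.1 • p.2)‖ₑ ∂ρ) ^ 2 ≤
      ENNReal.ofReal (√K₃ * R ^ (-(s + t - d - 1) / 2)) ^ 2 := by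
    refine (sq_lintegral_le_measure_univ_mul_lintegral_sq ρ hmeas.aemeasurable).trans ?_
    grw [hJ, hρu, ← ENNReal.ofReal_mul (by positivity)]
    rw [← ENNReal.ofReal_pow (by positivity), mul_pow, Real.sq_sqrt hK₃0,
      ← Real.rpow_mul_natCast hR0.le]
    refine ENNReal.ofReal_le_ofReal (le_of_eq ?_)
    have : R ^ (-(s + t - d - 1) / 2 * ((2 : ℕ) : ℝ)) = R * R ^ (d - s - t) := by
      nth_rewrite 2 [← Real.rpow_one R]
      rw [← Real.rpow_add hR0]; congr 1; push_cast; ring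
    rw [this, hK₃]; ring
  rw [← lintegral_prod _ hmeas.aemeasurable]
  exact (ENNReal.pow_le_pow_left_iff two_ne_zero).1 hsq

/-- If `η` does not charge a neighbourhood of the origin and `charFun η` is integrable, then its
integral (the "density of `η` at the origin") vanishes. -/
theorem integral_charFun_eq_zero_of_ball {η : Measure V} [IsFiniteMeasure η] {ε : ℝ}
    (hε : 0 < ε) (h : η (Metric.ball 0 ε) = 0) (hint : Integrable (charFun η)) :
    ∫ ξ, charFun η ξ = 0 := by
  set d : ℝ := (Module.finrank ℝ V : ℝ) with hd
  have hlhs : Filter.Tendsto (fun k : ℝ => ∫ ξ, charFun η ξ * Complex.exp (-(k⁻¹ : ℝ) * ‖ξ‖ ^ 2))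
      Filter.atTop (𝓝 (∫ ξ, charFun η ξ)) := by
    refine tendsto_integral_filter_of_dominated_convergence (fun ξ => ‖charFun η ξ‖)
      (.of_forall fun k => hint.aestronglyMeasurable.mul (by fun_prop)) ?_ hint.norm
      (.of_forall fun ξ => ?_)
    · filter_upwards [Filter.eventually_gt_atTop 0] with k hk
      refine .of_forall fun ξ => ?_
      rw [norm_mul]
      refine mul_le_of_le_one_right (norm_nonneg _) ?_
      rw [← Complex.ofReal_neg, ← Complex.ofReal_pow, ← Complex.ofReal_mul, Complex.norm_exp_ofReal,
        Real.exp_le_one_iff, neg_mul, neg_nonpos]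
      positivity
    · have h1 : Filter.Tendsto (fun k : ℝ => (k⁻¹ : ℝ)) Filter.atTop (𝓝 0) :=
        tendsto_inv_atTop_zero
      have h2 : Continuous fun b : ℝ => charFun η ξ * Complex.exp (-(b : ℂ) * ‖ξ‖ ^ 2) := by
        fun_prop
      simpa [Function.comp_def] using (h2.tendsto 0).comp h1
  have hrhs : Filter.Tendsto (fun k : ℝ => ∫ ξ, charFun η ξ * Complex.exp (-(k⁻¹ : ℝ) * ‖ξ‖ ^ 2))
      Filter.atTop (𝓝 0) := by
    have hb := (tendsto_rpow_mul_exp_neg_mul_atTop_nhds_zero (d / 2) (ε ^ 2 / 4)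
      (by positivity)).const_mul (Real.pi ^ (d / 2) * η.real univ)
    rw [mul_zero] at hb
    refine squeeze_zero_norm' ?_ hb
    filter_upwards [Filter.eventually_gt_atTop 0] with k hk
    have hfg := integral_charFun_add_mul_gaussian η (inv_pos.2 hk) 0
    simp only [zero_add, inner_zero_right, Complex.ofReal_zero, zero_mul, Complex.exp_zero,
      one_mul] at hfg
    rw [hfg, norm_mul]
    have h1 : ‖(Real.pi / (k⁻¹ : ℝ) : ℂ) ^ (Module.finrank ℝ V / 2 : ℂ)‖ =
        Real.pi ^ (d / 2) * k ^ (d / 2) := by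
      rw [← Real.mul_rpow Real.pi_nonneg hk.le, ← Complex.ofReal_div, div_inv_eq_mul,
        Complex.norm_cpow_eq_rpow_re_of_pos (by positivity)]
      congr 1
      simp [hd]
    have h2 : ‖∫ z, (Real.exp (-‖z‖ ^ 2 / (4 * k⁻¹)) : ℂ) ∂η‖ ≤
        Real.exp (-(ε ^ 2 / 4) * k) * η.real univ := by
      refine norm_integral_le_of_norm_le_const ?_
      have : ∀ᵐ z ∂η, z ∉ Metric.ball (0 : V) ε := by
        simpa only [ae_iff, not_not, ofPred_mem_eq] using h
      filter_upwards [this] with z hz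
      rw [mem_ball_zero_iff, not_lt] at hz
      rw [Complex.norm_real, Real.norm_of_nonneg (Real.exp_nonneg _), Real.exp_le_exp]
      have : ε ^ 2 ≤ ‖z‖ ^ 2 := by gcongr
      have h3 : -‖z‖ ^ 2 / (4 * k⁻¹) = -(‖z‖ ^ 2 / 4) * k := by field_simp
      rw [h3]
      gcongr
    rw [h1]
    calc _ ≤ Real.pi ^ (d / 2) * k ^ (d / 2) *
          (Real.exp (-(ε ^ 2 / 4) * k) * η.real univ) := by gcongr
      _ = _ := by ring
  exact tendsto_nhds_unique hlhs hrhs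

theorem isFiniteMeasure_withDensity_gaussian (μ : Measure V) [IsFiniteMeasure μ] :
    IsFiniteMeasure (μ.withDensity fun z => ENNReal.ofReal (Real.exp (-‖z‖ ^ 2 / 4))) := by
  refine isFiniteMeasure_withDensity_ofReal ?_
  refine (Integrable.of_bound (by fun_prop) 1 (.of_forall fun z => ?_) :
    Integrable (fun z => Real.exp (-‖z‖ ^ 2 / 4)) μ).2
  rw [Real.norm_of_nonneg (Real.exp_nonneg _), Real.exp_le_one_iff]
  have : 0 ≤ ‖z‖ ^ 2 / 4 := by positivity
  linarith [neg_div 4 (‖z‖ ^ 2)]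

theorem ae_integrable_charFun_smul {μ ν : Measure V} [IsFiniteMeasure μ]
    [IsFiniteMeasure ν] {s t C D : ℝ} (ht : 0 ≤ t) (hC : 0 ≤ C) (hD : 0 ≤ D)
    (hμ : ∀ x, ∀ r : ℝ, 0 < r → μ (Metric.closedBall x r) ≤ ENNReal.ofReal (C * r ^ s))
    (hν : ∀ x, ∀ r : ℝ, 0 < r → ν (Metric.closedBall x r) ≤ ENNReal.ofReal (D * r ^ t))
    (hν1 : ∀ᵐ e ∂ν, ‖e‖ = 1) (hst : (Module.finrank ℝ V : ℝ) + 1 < s + t) :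
    ∀ᵐ e ∂ν, Integrable fun r : ℝ => charFun (μ.withDensity fun z =>
      ENNReal.ofReal (Real.exp (-‖z‖ ^ 2 / 4))) (r • e) := by
  obtain ⟨K, hK, hR⟩ := exists_lintegral_charFun_annulus_le ht hC hD hμ hν hν1
  set μ' := μ.withDensity fun z => ENNReal.ofReal (Real.exp (-‖z‖ ^ 2 / 4)) with hμ'
  have : IsFiniteMeasure μ' := isFiniteMeasure_withDensity_gaussian μ
  set δ := (s + t - Module.finrank ℝ V - 1) / 2 with hδ
  have hδ0 : 0 < δ := by rw [hδ]; linarith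
  have hmeas : Measurable fun p : ℝ × V => ‖charFun μ' (p.1 • p.2)‖ₑ :=
    (measurable_charFun.comp (measurable_fst.smul measurable_snd)).enorm
  have hcover : Ici (1 : ℝ) ⊆ ⋃ k : ℕ, Icc ((2 : ℝ) ^ k) (2 * 2 ^ k) := fun r hr => by
    obtain ⟨k, h1, h2⟩ := exists_nat_pow_near (mem_Ici.1 hr) one_lt_two
    exact mem_iUnion.2 ⟨k, h1, by rw [← pow_succ']; exact h2.le⟩
  have hgeom : ∑' k : ℕ, ENNReal.ofReal (K * ((2 : ℝ) ^ k) ^ (-δ)) ≠ ⊤ := by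
    refine Summable.tsum_ofReal_ne_top (Summable.mul_left _ ?_)
    have : (fun k : ℕ => ((2 : ℝ) ^ k) ^ (-δ)) = fun k : ℕ => ((2 : ℝ) ^ (-δ)) ^ k := by
      ext k
      rw [← Real.rpow_natCast_mul zero_le_two, ← Real.rpow_mul_natCast zero_le_two, mul_comm]
    rw [this]
    exact summable_geometric_of_lt_one (by positivity)
      (Real.rpow_lt_one_of_one_lt_of_neg one_lt_two (by linarith))
  have hfin : ∫⁻ e, (∫⁻ r in Ici (1 : ℝ), ‖charFun μ' (r • e)‖ₑ) ∂ν ≠ ⊤ := by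
    rw [← lintegral_lintegral_swap hmeas.aemeasurable]
    refine ne_top_of_le_ne_top hgeom ?_
    calc _ ≤ ∫⁻ r in ⋃ k : ℕ, Icc ((2 : ℝ) ^ k) (2 * 2 ^ k), ∫⁻ e, ‖charFun μ' (r • e)‖ₑ ∂ν :=
          lintegral_mono_set hcover
      _ ≤ _ := lintegral_iUnion_le _ _
      _ ≤ _ := ENNReal.tsum_le_tsum fun k => by
          rw [hδ, ← neg_div]
          exact hR _ (one_le_pow₀ one_le_two)
  have hae : ∀ᵐ e ∂ν, ∫⁻ r in Ici (1 : ℝ), ‖charFun μ' (r • e)‖ₑ < ⊤ :=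
    ae_lt_top hmeas.lintegral_prod_left' hfin
  filter_upwards [hae] with e he
  have hm : StronglyMeasurable fun r : ℝ => charFun μ' (r • e) :=
    (measurable_charFun.comp (measurable_id.smul_const e)).stronglyMeasurable
  refine integrable_of_norm_neg_eq hm (fun r => ?_) ?_
  · rw [neg_smul, charFun_neg, RCLike.norm_conj]
  · rw [← Icc_union_Ici_eq_Ici zero_le_one]
    refine IntegrableOn.union ?_ ⟨hm.aestronglyMeasurable, he⟩
    exact .of_bound (by simp) hm.aestronglyMeasurable (μ'.real univ)
      (.of_forall fun r => norm_charFun_le _)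

end Gaussian

/-- A nonzero finite measure on the line with integrable characteristic function cannot be carried
by a closed set with empty interior. -/
theorem interior_nonempty_of_integrable_charFun {η : Measure ℝ} [IsFiniteMeasure η] (hη : η ≠ 0)
    {K : Set ℝ} (hK : IsClosed K) (hKη : η Kᶜ = 0) (hint : Integrable (charFun η)) :
    (interior K).Nonempty := by
  by_contra hemp
  rw [not_nonempty_iff_eq_empty, interior_eq_empty_iff_dense_compl] at hemp
  have hfourier (w : ℝ) : FourierTransform.fourier (charFun η) w =
      ∫ r, charFun (η.map (· + -(2 * Real.pi * w))) r := by
    rw [Real.fourier_real_eq_integral_exp_smul]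
    refine integral_congr_ae (.of_forall fun r => ?_)
    simp only [charFun_map_add_const, smul_eq_mul]
    rw [mul_comm]
    congr 3
    simp
    ring
  have hzero (w : ℝ) (hw : 2 * Real.pi * w ∈ Kᶜ) :
      FourierTransform.fourier (charFun η) w = 0 := by
    obtain ⟨ε, hε, hball⟩ := Metric.isOpen_iff.1 hK.isOpen_compl _ hw
    rw [hfourier]
    refine integral_charFun_eq_zero_of_ball hε ?_ ?_
    · rw [Measure.map_apply (by fun_prop) measurableSet_ball]
      refine measure_mono_null (fun z hz => hball ?_) hKη
      simpa [Real.dist_eq, sub_eq_add_neg] using hz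
    · refine hint.mono (stronglyMeasurable_charFun.aestronglyMeasurable) (.of_forall fun r => ?_)
      rw [charFun_map_add_const, norm_mul, Complex.norm_exp_ofReal_mul_I, mul_one]
  have hcont : Continuous (FourierTransform.fourier (charFun η)) :=
    VectorFourier.fourierIntegral_continuous Real.continuous_fourierChar
      (by fun_prop) hint
  have hdense : Dense {w : ℝ | 2 * Real.pi * w ∈ Kᶜ} :=
    hemp.preimage (Homeomorph.mulLeft₀ (2 * Real.pi) (by positivity)).isOpenMap
  have hF : FourierTransform.fourier (charFun η) = 0 :=
    hcont.ext_on hdense continuous_zero fun w hw => hzero w hw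
  have hinv := continuous_charFun.fourierInv_fourier_eq hint (by rw [hF]; exact integrable_zero _ _ _)
  have h0 : charFun η 0 = 0 := by
    rw [← hinv, hF]
    simp [Real.fourierInv_eq']
  rw [charFun_zero, Complex.ofReal_eq_zero, measureReal_eq_zero_iff] at h0
  exact hη (Measure.measure_univ_eq_zero.1 h0)

/-- Some direction in a large set of directions projects a large compact set onto a set with
nonempty interior. -/
theorem exists_interior_inner_image_nonempty {n : ℕ} {E F : Set (EuclideanSpace ℝ (Fin n))}
    (hE : IsCompact E) (hF : IsCompact F) (hF1 : ∀ e ∈ F, ‖e‖ = 1) {s t : ℝ≥0}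
    (hs : (s : ℝ≥0∞) < dimH E) (ht : (t : ℝ≥0∞) < dimH F) (hst : (n : ℝ≥0) + 1 < s + t) :
    ∃ e ∈ F, (interior ((fun x => inner ℝ x e) '' E)).Nonempty := by
  obtain ⟨μ, _, hμ0, hμE, C, hC, hμ⟩ := exists_frostman_measure hE hs
  obtain ⟨ν, _, hν0, hνF, D, hD, hν⟩ := exists_frostman_measure hF ht
  have hνF' : ∀ᵐ e ∂ν, e ∈ F := hνF
  have hae := ae_integrable_charFun_smul t.coe_nonneg hC hD hμ hν
    (hνF'.mono hF1) (by rw [finrank_euclideanSpace_fin]; exact_mod_cast hst)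
  have : NeZero ν := ⟨fun h => hν0 (by simp [h])⟩
  obtain ⟨e, heF, he⟩ := (hνF'.and hae).exists
  refine ⟨e, heF, ?_⟩
  have hfin := isFiniteMeasure_withDensity_gaussian μ
  have hac := withDensity_absolutelyContinuous μ fun z => ENNReal.ofReal (Real.exp (-‖z‖ ^ 2 / 4))
  have hac' : μ ≪ μ.withDensity fun z => ENNReal.ofReal (Real.exp (-‖z‖ ^ 2 / 4)) :=
    withDensity_absolutelyContinuous' (by fun_prop)
      (.of_forall fun z => (ENNReal.ofReal_pos.2 (Real.exp_pos _)).ne')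
  set μ' := μ.withDensity fun z => ENNReal.ofReal (Real.exp (-‖z‖ ^ 2 / 4))
  have hL : Continuous fun x : EuclideanSpace ℝ (Fin n) => inner ℝ x e := by fun_prop
  have hK := (hE.image hL).isClosed
  refine interior_nonempty_of_integrable_charFun (η := μ'.map fun x => inner ℝ x e) ?_ hK ?_ ?_
  · rw [Ne, Measure.map_eq_zero_iff hL.aemeasurable]
    exact fun h => hμ0 (hac' (by simp [h]))
  · rw [Measure.map_apply hL.measurable hK.measurableSet.compl]
    exact measure_mono_null (fun x hx hxE => hx (mem_image_of_mem _ hxE)) (hac hμE)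
  · refine he.congr (.of_forall fun r => ?_)
    simp only
    rw [charFun_apply, charFun_apply_real, integral_map hL.aemeasurable (by fun_prop)]
    refine integral_congr_ae (.of_forall fun x => ?_)
    simp [inner_smul_right]

/-- A `C¹` immersion is locally bi-Lipschitz, hence maps some small compact piece of a compact set
to a set of no smaller dimension. -/
theorem exists_isCompact_subset_lt_dimH_image {X Y : Type*} [NormedAddCommGroup X]
    [NormedSpace ℝ X] [FiniteDimensional ℝ X] [NormedAddCommGroup Y] [NormedSpace ℝ Y]
    {f : X → Y} {U A : Set X} (hU : IsOpen U) (hf : ContDiffOn ℝ 1 f U)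
    (hinj : ∀ x ∈ U, Function.Injective (fderiv ℝ f x)) (hA : IsCompact A) (hAU : A ⊆ U)
    {r : ℝ≥0∞} (hr : r < dimH A) :
    ∃ A' ⊆ A, IsCompact A' ∧ r < dimH (f '' A') := by
  obtain ⟨x, hxA, hx⟩ := exists_mem_nhdsWithin_lt_dimH_of_lt_dimH hr
  have hstrict : HasStrictFDerivAt f (fderiv ℝ f x) x :=
    (hf.contDiffAt (hU.mem_nhds (hAU hxA))).hasStrictFDerivAt one_ne_zero
  obtain ⟨K, hK0, hK⟩ := (fderiv ℝ f x).toLinearMap.exists_antilipschitzWith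
    (LinearMap.ker_eq_bot.2 (hinj x (hAU hxA)))
  have hc : K⁻¹ / 2 < K⁻¹ := NNReal.half_lt_self (inv_ne_zero hK0.ne')
  obtain ⟨S, hS, happ⟩ := hstrict.approximates_deriv_on_nhds (c := K⁻¹ / 2)
    (Or.inr (by positivity))
  obtain ⟨ε, hε, hball⟩ := Metric.nhds_basis_closedBall.mem_iff.1 hS
  have hanti : AntilipschitzWith (K⁻¹ - K⁻¹ / 2)⁻¹ (S.domRestrict f) := by
    convert! (hK.domRestrict S).add_lipschitzWith happ.lipschitz_sub hc using 1
    ext y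
    simp [domRestrict]
  refine ⟨A ∩ Metric.closedBall x ε, inter_subset_left,
    hA.inter_right Metric.isClosed_closedBall, ?_⟩
  have hsub : A ∩ Metric.closedBall x ε ⊆ S := inter_subset_right.trans hball
  refine (hx _ (inter_mem_nhdsWithin A (Metric.closedBall_mem_nhds x hε))).trans_le ?_
  have himg : f '' (A ∩ Metric.closedBall x ε) =
      S.domRestrict f '' ((↑) ⁻¹' (A ∩ Metric.closedBall x ε)) := by
    rw [domRestrict_eq, image_comp, Subtype.image_preimage_coe, inter_eq_right.2 hsub]
  rw [himg]
  refine le_trans (le_of_eq ?_) (hanti.le_dimH_image _)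
  rw [← (isometry_subtype_coe (s := S)).dimH_image, Subtype.image_preimage_coe,
    inter_eq_right.2 hsub]

theorem injective_of_rank_eq {k n : ℕ}
    {L : EuclideanSpace ℝ (Fin k) →L[ℝ] EuclideanSpace ℝ (Fin n)}
    (h : LinearMap.rank L.toLinearMap = k) : Function.Injective L := by
  have h1 : Module.finrank ℝ (LinearMap.range L.toLinearMap) = k :=
    Module.finrank_eq_of_rank_eq h
  have h2 := LinearMap.finrank_range_add_finrank_ker L.toLinearMap
  rw [h1, finrank_euclideanSpace_fin] at h2
  exact LinearMap.ker_eq_bot.1 (Submodule.finrank_eq_zero.1 (by omega))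

theorem dimH_le_natCast {k : ℕ} (S : Set (EuclideanSpace ℝ (Fin k))) : dimH S ≤ k := by
  grw [dimH_mono (subset_univ S), Real.dimH_univ_eq_finrank, finrank_euclideanSpace_fin]

theorem exists_nnreal_lt_lt_add {a b c : ℝ≥0} (ha : a ≤ c) (hb : b ≤ c) (h : c < a + b) :
    ∃ s < a, ∃ t < b, c < s + t := by
  obtain ⟨s, hs, hsa⟩ := exists_between ((tsub_lt_iff_right hb).2 h)
  rw [tsub_lt_iff_right hb] at hs
  have hsc : s ≤ c := hsa.le.trans ha
  obtain ⟨t, ht, htb⟩ := exists_between ((tsub_lt_iff_left hsc).2 hs)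
  exact ⟨s, hsa, t, htb, (tsub_lt_iff_left hsc).1 ht⟩

end

/-- STATEMENT 0: If `Φ(x,y) = Σ P_k(x) Q_k(y)` with `P`, `ρ∘Q` smooth of maximal rank,
`A ⊆ U`, `B ⊆ V` compact and `dim_H A + dim_H B > n+1`, then for some `y ∈ B` the pinned image
`Δ_{Φ,y}(A)` has nonempty interior. -/
theorem stmt_1 (m n p : ℕ) (hm : 1 ≤ m) (hmn : m ≤ n) (hp : 1 ≤ p) (hpn : p ≤ n - 1)
    (U : Set (EuclideanSpace ℝ (Fin m))) (V : Set (EuclideanSpace ℝ (Fin p)))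
    (hU : IsOpen U) (hV : IsOpen V)
    (P : EuclideanSpace ℝ (Fin m) → EuclideanSpace ℝ (Fin n))
    (Q : EuclideanSpace ℝ (Fin p) → EuclideanSpace ℝ (Fin n))
    (hP : ContDiffOn ℝ (⊤ : ℕ∞) P U)
    (hQ : ContDiffOn ℝ (⊤ : ℕ∞) Q V)
    (hQ0 : ∀ y ∈ V, Q y ≠ 0)
    (hPrank : ∀ x ∈ U, LinearMap.rank (fderiv ℝ P x).toLinearMap = m)
    (hQrank : ∀ y ∈ V,
      LinearMap.rank (fderiv ℝ (fun z => ‖Q z‖⁻¹ • Q z) y).toLinearMap = p)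
    (A : Set (EuclideanSpace ℝ (Fin m))) (B : Set (EuclideanSpace ℝ (Fin p)))
    (hA : IsCompact A) (hB : IsCompact B) (hAU : A ⊆ U) (hBV : B ⊆ V)
    (hdim : dimH A + dimH B > (n : ℝ≥0∞) + 1) :
    ∃ y ∈ B, (interior ((fun x => ∑ k, P x k * Q y k) '' A)).Nonempty := by
  have hPc : ContDiffOn ℝ 1 P U := hP.of_le (mod_cast le_top)
  have hQc : ContDiffOn ℝ 1 Q V := hQ.of_le (mod_cast le_top)
  have hρQ : ContDiffOn ℝ 1 (fun z => ‖Q z‖⁻¹ • Q z) V :=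
    ((hQc.norm ℝ hQ0).inv fun y hy => norm_ne_zero_iff.2 (hQ0 y hy)).smul hQc
  have hAm := dimH_le_natCast A
  have hBp := dimH_le_natCast B
  lift dimH A to NNReal using (hAm.trans_lt (ENNReal.natCast_lt_top m)).ne with a ha
  lift dimH B to NNReal using (hBp.trans_lt (ENNReal.natCast_lt_top p)).ne with b hb
  norm_cast at hAm hBp hdim
  have ham : a ≤ (n : NNReal) + 1 :=
    hAm.trans (by exact_mod_cast (by omega : m ≤ n + 1))
  have hbp : b ≤ (n : NNReal) + 1 :=
    hBp.trans (by exact_mod_cast (by omega : p ≤ n + 1))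
  obtain ⟨s, hsa, t, htb, hst⟩ := exists_nnreal_lt_lt_add ham hbp (by exact_mod_cast hdim)
  obtain ⟨A', hA'A, hA', hsA'⟩ := exists_isCompact_subset_lt_dimH_image hU hPc
    (fun x hx => injective_of_rank_eq (hPrank x hx)) hA hAU (r := s)
    (by rw [← ha]; exact_mod_cast hsa)
  obtain ⟨B', hB'B, hB', htB'⟩ := exists_isCompact_subset_lt_dimH_image hV hρQ
    (fun y hy => injective_of_rank_eq (hQrank y hy)) hB hBV (r := t)
    (by rw [← hb]; exact_mod_cast htb)
  have hE := hA'.image_of_continuousOn (hPc.continuousOn.mono (hA'A.trans hAU))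
  have hF := hB'.image_of_continuousOn (hρQ.continuousOn.mono (hB'B.trans hBV))
  obtain ⟨_, ⟨y, hy, rfl⟩, hint⟩ := exists_interior_inner_image_nonempty hE hF (by
    rintro _ ⟨y, hy, rfl⟩
    simpa using norm_smul_inv_norm (𝕜 := ℝ) (hQ0 y (hBV (hB'B hy)))) hsA' htB' hst
  have hQy : ‖Q y‖ ≠ 0 := norm_ne_zero_iff.2 (hQ0 y (hBV (hB'B hy)))
  refine ⟨y, hB'B hy, ?_⟩
  have himg := hint.image (Homeomorph.mulLeft₀ ‖Q y‖ hQy)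
  rw [Homeomorph.image_interior] at himg
  refine himg.mono (interior_mono ?_)
  rintro _ ⟨_, ⟨_, ⟨x, hx, rfl⟩, rfl⟩, rfl⟩
  refine ⟨x, hA'A hx, ?_⟩
  simp only [Homeomorph.coe_mulLeft₀, inner_smul_right, mul_inv_cancel_left₀ hQy,
    PiLp.inner_apply]
  exact Finset.sum_congr rfl fun k _ => by simp [mul_comm]
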